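/- For every integer L ≥ 1, 2·N_D(L) = N_C(L) + binom(L, ⌊L/2⌋). (This is Corollary 1: N_{Z,sq,PF,L} = (1/2)·[N_{Z,tri,PF,L} + binom(L, ⌊L/2⌋)], using the identity (1/2)·binom(L+1, (L+1)/2) = binom(L, ⌊L/2⌋) for odd L.) -/

import Mathlib

/-- Four points of `ZMod L` occur in this (strict) cyclic order around the circle. -/
def CycOrd (L : ℕ) (a b c d : ZMod L) : Prop :=
  ∃ t : ZMod L, (a - t).val < (b - t).val ∧ (b - t).val < (c - t).val ∧
    (c - t).val < (d - t).val

/-- A partition (setoid) of `ZMod L` is non-crossing: there are no four points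
`a, b, c, d` in cyclic order with `a ~ c`, `b ~ d` but `a` and `b` in different blocks. -/
def IsNC (L : ℕ) (P : Setoid (ZMod L)) : Prop :=
  ¬ ∃ a b c d : ZMod L, CycOrd L a b c d ∧ P.r a c ∧ P.r b d ∧ ¬ P.r a b

/-- The set of non-crossing partitions of `ZMod L`. -/
def NCPart (L : ℕ) := {P : Setoid (ZMod L) // IsNC L P}

/-- Two non-crossing partitions are related by a rotation `x ↦ x + t`. -/
def rotRel (L : ℕ) (P Q : NCPart L) : Prop :=
  ∃ t : ZMod L, ∀ x y : ZMod L, P.1.r x y ↔ Q.1.r (x + t) (y + t)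

/-- Two non-crossing partitions are related by an element of the dihedral group,
i.e. by a map `x ↦ x + t` or `x ↦ -x + t`. -/
def dihRel (L : ℕ) (P Q : NCPart L) : Prop :=
  ∃ t : ZMod L, (∀ x y : ZMod L, P.1.r x y ↔ Q.1.r (x + t) (y + t)) ∨
    (∀ x y : ZMod L, P.1.r x y ↔ Q.1.r (-x + t) (-y + t))

/-- `N_C L`: the number of orbits of non-crossing partitions of `ZMod L`
under the rotation action (the paper's `N_{Z,tri,PF,L}`). -/
noncomputable def N_C (L : ℕ) : ℕ := Nat.card (Quot (rotRel L))

/-- `N_D L`: the number of orbits of non-crossing partitions of `ZMod L`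
under the dihedral action (the paper's `N_{Z,sq,PF,L}`). -/
noncomputable def N_D (L : ℕ) : ℕ := Nat.card (Quot (dihRel L))

theorem val_sub_formula {L : ℕ} [NeZero L] (a b : ZMod L) :
    (a - b).val = if b.val ≤ a.val then a.val - b.val else a.val + L - b.val := by
  split_ifs with h
  · exact ZMod.val_sub h
  · have ha := ZMod.val_lt a
    have hb := ZMod.val_lt b
    have h1 : (b - a).val = b.val - a.val := ZMod.val_sub (by omega)
    have h2 : a - b = -(b - a) := by ring
    have h3 : b - a ≠ 0 := by
      intro h0
      rw [h0] at h1
      simp at h1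
      omega
    have : NeZero (b - a) := ⟨h3⟩
    rw [h2, ZMod.val_neg_of_ne_zero, h1]
    omega

theorem val_neg_one_formula {L : ℕ} [NeZero L] : (-1 : ZMod L).val = L - 1 := by
  obtain ⟨n, rfl⟩ : ∃ n, L = n + 1 := ⟨L - 1, by have := NeZero.pos L; omega⟩
  simp [ZMod.val_neg_one]

theorem val_compl {L : ℕ} [NeZero L] (a : ZMod L) : (-a + -1).val = L - 1 - a.val := by
  have h : -a + -1 = -1 - a := by ring
  rw [h, val_sub_formula, val_neg_one_formula, if_pos]
  have := ZMod.val_lt a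
  omega

/-- Linear version of the non-crossing condition. -/
theorem isNC_iff {L : ℕ} [NeZero L] (P : Setoid (ZMod L)) :
    IsNC L P ↔ ∀ a b c d : ZMod L, a.val < b.val → b.val < c.val → c.val < d.val →
      P.r a c → P.r b d → P.r a b := by
  constructor
  · intro h a b c d h1 h2 h3 hac hbd
    by_contra hab
    exact h ⟨a, b, c, d, ⟨0, by simpa using ⟨h1, h2, h3⟩⟩, hac, hbd, hab⟩
  · rintro h ⟨a, b, c, d, ⟨t, h1, h2, h3⟩, hac, hbd, hab⟩
    have ha := ZMod.val_lt a
    have hb := ZMod.val_lt b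
    have hc := ZMod.val_lt c
    have hd := ZMod.val_lt d
    have ht := ZMod.val_lt t
    have hcases : (a.val < b.val ∧ b.val < c.val ∧ c.val < d.val) ∨
        (b.val < c.val ∧ c.val < d.val ∧ d.val < a.val) ∨
        (c.val < d.val ∧ d.val < a.val ∧ a.val < b.val) ∨
        (d.val < a.val ∧ a.val < b.val ∧ b.val < c.val) := by
      simp only [val_sub_formula] at h1 h2 h3
      split_ifs at h1 h2 h3 <;> omega
    apply hab
    have hca := P.symm' hac
    have hdb := P.symm' hbd
    rcases hcases with ⟨g1, g2, g3⟩ | ⟨g1, g2, g3⟩ | ⟨g1, g2, g3⟩ | ⟨g1, g2, g3⟩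
    · exact h a b c d g1 g2 g3 hac hbd
    · exact P.trans' hac (P.symm' (h b c d a g1 g2 g3 hbd hca))
    · exact P.trans' hac (P.trans' (h c d a b g1 g2 g3 hca hdb) hdb)
    · exact P.trans' (P.symm' (h d a b c g1 g2 g3 hdb hac)) hdb

instance {L : ℕ} [NeZero L] : Finite (NCPart L) := by
  apply Finite.of_injective (fun P : NCPart L => (fun x y => P.1.r x y))
  intro P Q h
  apply Subtype.ext
  apply Setoid.ext
  intro x y
  exact iff_of_eq (congrFun (congrFun h x) y)

theorem NCPart_ext {L : ℕ} {P Q : NCPart L} (h : ∀ x y, P.1.r x y ↔ Q.1.r x y) : P = Q :=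
  Subtype.ext (Setoid.ext h)

/-- The action of the dihedral group on the circle. -/
def dact {L : ℕ} : DihedralGroup L → ZMod L → ZMod L
  | DihedralGroup.r i, x => x + i
  | DihedralGroup.sr i, x => -x + -i

theorem dact_mul {L : ℕ} (g h : DihedralGroup L) (x : ZMod L) :
    dact (g * h) x = dact g (dact h x) := by
  cases g <;> cases h <;> simp [dact] <;> ring

theorem dact_one {L : ℕ} (x : ZMod L) : dact 1 x = x := by
  rw [DihedralGroup.one_def]; simp [dact]

theorem isNC_dact {L : ℕ} [NeZero L] (g : DihedralGroup L) (P : Setoid (ZMod L))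
    (hP : IsNC L P) : IsNC L (P.comap (dact g)) := by
  rintro ⟨a, b, c, d, ⟨t, h1, h2, h3⟩, hac, hbd, hab⟩
  have hac : P.r (dact g a) (dact g c) := hac
  have hbd : P.r (dact g b) (dact g d) := hbd
  have hab : ¬ P.r (dact g a) (dact g b) := hab
  apply hP
  cases g with
  | r i =>
    exact ⟨_, _, _, _, ⟨t + i, by simpa [dact] using ⟨h1, h2, h3⟩⟩, hac, hbd, hab⟩
  | sr i =>
    have key : ∀ x : ZMod L, (dact (DihedralGroup.sr i) x - (-t + 1 - i)).val
        = L - 1 - (x - t).val := by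
      intro x
      rw [← val_compl]
      congr 1
      simp only [dact]
      ring
    have := ZMod.val_lt (d - t)
    refine ⟨_, _, _, _, ⟨-t + 1 - i, ?_, ?_, ?_⟩, P.symm' hbd, P.symm' hac, ?_⟩
    · rw [key, key]; omega
    · rw [key, key]; omega
    · rw [key, key]; omega
    · intro hh
      exact hab (P.trans' (P.trans' hac (P.symm' hh)) (P.symm' hbd))

instance {L : ℕ} [NeZero L] : MulAction (DihedralGroup L) (NCPart L) where
  smul g P := ⟨P.1.comap (dact g⁻¹), isNC_dact _ _ P.2⟩
  one_smul P := by
    apply NCPart_ext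
    intro x y
    change P.1.r (dact _ _) (dact _ _) ↔ _
    rw [inv_one, dact_one, dact_one]
  mul_smul g h P := by
    apply NCPart_ext
    intro x y
    change P.1.r (dact _ _) (dact _ _) ↔ P.1.r (dact _ (dact _ _)) (dact _ (dact _ _))
    rw [mul_inv_rev, dact_mul, dact_mul]

theorem smul_rel {L : ℕ} [NeZero L] (g : DihedralGroup L) (P : NCPart L) (x y : ZMod L) :
    (g • P).1.r x y ↔ P.1.r (dact g⁻¹ x) (dact g⁻¹ y) := Iff.rfl

theorem smul_eq_iff {L : ℕ} [NeZero L] (g : DihedralGroup L) (P Q : NCPart L) :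
    g • P = Q ↔ ∀ x y, P.1.r x y ↔ Q.1.r (dact g x) (dact g y) := by
  constructor
  · rintro rfl x y
    rw [smul_rel, ← dact_mul, ← dact_mul, inv_mul_cancel, dact_one, dact_one]
  · intro h
    apply NCPart_ext
    intro x y
    rw [smul_rel, h, ← dact_mul, ← dact_mul, mul_inv_cancel, dact_one, dact_one]

def rHom (L : ℕ) : Multiplicative (ZMod L) →* DihedralGroup L where
  toFun i := DihedralGroup.r i.toAdd
  map_one' := rfl
  map_mul' a b := by simp

/-- Rotation action. -/
instance rotAct {L : ℕ} [NeZero L] : MulAction (Multiplicative (ZMod L)) (NCPart L) :=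
  MulAction.compHom _ (rHom L)

/-- Partitions fixed by the reflection `x ↦ -x + t`. -/
def Fx (L : ℕ) (t : ZMod L) : Set (NCPart L) :=
  {P | ∀ x y : ZMod L, P.1.r x y ↔ P.1.r (-x + t) (-y + t)}

def dihEquiv (L : ℕ) : (ZMod L) ⊕ (ZMod L) ≃ DihedralGroup L where
  toFun := Sum.elim (fun i => DihedralGroup.r i) (fun i => DihedralGroup.sr i)
  invFun g := match g with
    | DihedralGroup.r i => Sum.inl i
    | DihedralGroup.sr i => Sum.inr i
  left_inv := by rintro (i | i) <;> rfl
  right_inv := by rintro (i | i) <;> rfl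

theorem burnside_pair (L : ℕ) [NeZero L] (N : ℕ)
    (hN : ∀ t : ZMod L, Nat.card (Fx L t) = N) :
    2 * N_D L = N_C L + N := by
  classical
  have := Fintype.ofFinite (NCPart L)
  have hC : N_C L = Nat.card (Quotient (MulAction.orbitRel (Multiplicative (ZMod L)) (NCPart L))) := by
    apply Nat.card_congr
    apply Quot.congrRight
    intro P Q
    change _ ↔ P ∈ MulAction.orbit _ Q
    rw [← MulAction.orbitRel_apply, Setoid.comm', MulAction.orbitRel_apply, MulAction.mem_orbit_iff]
    constructor
    · rintro ⟨t, ht⟩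
      exact ⟨Multiplicative.ofAdd t, (smul_eq_iff (DihedralGroup.r t) P Q).2 ht⟩
    · rintro ⟨t, ht⟩
      exact ⟨t.toAdd, (smul_eq_iff (DihedralGroup.r t.toAdd) P Q).1 ht⟩
  have hD : N_D L = Nat.card (Quotient (MulAction.orbitRel (DihedralGroup L) (NCPart L))) := by
    apply Nat.card_congr
    apply Quot.congrRight
    intro P Q
    change _ ↔ P ∈ MulAction.orbit _ Q
    rw [← MulAction.orbitRel_apply, Setoid.comm', MulAction.orbitRel_apply, MulAction.mem_orbit_iff]
    constructor
    · rintro ⟨t, ht | ht⟩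
      · exact ⟨DihedralGroup.r t, (smul_eq_iff _ P Q).2 ht⟩
      · exact ⟨DihedralGroup.sr (-t), (smul_eq_iff _ P Q).2 (by simpa [dact] using ht)⟩
    · rintro ⟨t | t, ht⟩
      · exact ⟨t, Or.inl ((smul_eq_iff _ P Q).1 ht)⟩
      · exact ⟨-t, Or.inr ((smul_eq_iff _ P Q).1 ht)⟩
  have b1 := MulAction.sum_card_fixedBy_eq_card_orbits_mul_card_group (Multiplicative (ZMod L)) (NCPart L)
  have b2 := MulAction.sum_card_fixedBy_eq_card_orbits_mul_card_group (DihedralGroup L) (NCPart L)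
  rw [← Nat.card_eq_fintype_card, ← hC] at b1
  rw [← Nat.card_eq_fintype_card (α := Quotient _), ← hD] at b2
  rw [← (dihEquiv L).sum_comp, Fintype.sum_sum_type, DihedralGroup.card] at b2
  have e1 : ∑ i : ZMod L, Fintype.card (MulAction.fixedBy (NCPart L) (dihEquiv L (Sum.inl i)))
      = N_C L * L := by
    have : Fintype.card (Multiplicative (ZMod L)) = L := by
      rw [Fintype.card_multiplicative, ZMod.card]
    rw [this] at b1
    rw [← b1]
    refine Fintype.sum_equiv Multiplicative.ofAdd _ _ (fun i => ?_)
    exact Fintype.card_congr (Equiv.setCongr rfl)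
  have e2 : ∑ i : ZMod L, Fintype.card (MulAction.fixedBy (NCPart L) (dihEquiv L (Sum.inr i)))
      = N * L := by
    have : ∀ i : ZMod L, Fintype.card (MulAction.fixedBy (NCPart L) (dihEquiv L (Sum.inr i))) = N := by
      intro i
      rw [← hN (-i), ← Nat.card_eq_fintype_card]
      apply Nat.card_congr
      apply Equiv.setCongr
      ext P
      rw [MulAction.mem_fixedBy]
      exact smul_eq_iff (DihedralGroup.sr i) P P
    rw [Finset.sum_congr rfl (fun i _ => this i)]
    simp [ZMod.card, mul_comm]
  rw [e1, e2] at b2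
  have := NeZero.pos L
  apply Nat.eq_of_mul_eq_mul_right this
  linarith

/-- Kreweras complement relation. -/
def krew {L : ℕ} (P : Setoid (ZMod L)) : Setoid (ZMod L) where
  r x y := ∀ a b, P.r a b →
    ((a.val ≤ x.val ↔ b.val ≤ x.val) ↔ (a.val ≤ y.val ↔ b.val ≤ y.val))
  iseqv := ⟨fun _ _ _ _ => Iff.rfl, fun h a b hab => (h a b hab).symm,
    fun h1 h2 a b hab => (h1 a b hab).trans (h2 a b hab)⟩

theorem krew_r {L : ℕ} (P : Setoid (ZMod L)) (x y : ZMod L) : (krew P).r x y ↔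
    ∀ a b, P.r a b →
    ((a.val ≤ x.val ↔ b.val ≤ x.val) ↔ (a.val ≤ y.val ↔ b.val ≤ y.val)) := Iff.rfl

theorem krew_nc {L : ℕ} [NeZero L] (P : Setoid (ZMod L)) : IsNC L (krew P) := by
  rw [isNC_iff]
  intro a b c d h1 h2 h3 hac hbd p q hpq
  have := hac p q hpq
  have := hbd p q hpq
  omega

def Krew {L : ℕ} [NeZero L] (P : NCPart L) : NCPart L := ⟨krew P.1, krew_nc P.1⟩

theorem refl_cut {L : ℕ} [NeZero L] (t a x : ZMod L) :
    ((-a + t).val ≤ x.val) ↔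
      ((a.val ≤ (-x + (t - 1)).val) ↔ ¬ (a.val ≤ t.val ↔ x.val < t.val)) := by
  have ha := ZMod.val_lt a
  have hx := ZMod.val_lt x
  have ht := ZMod.val_lt t
  have e1 : -a + t = t - a := by ring
  have e2 : -x + (t - 1) = t - (-(-x + -1)) := by ring
  have e3 : -x + (t - 1) = (-x + -1) - (-t) := by ring
  have e4 : (-x + (t-1)).val = if x.val < t.val then t.val - 1 - x.val else t.val + L - 1 - x.val := by
    have : -x + (t - 1) = (t - x) - 1 := by ring
    have h5 : -(t - x) + -1 = - x + -1 - t + 2 * x := by ring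
    have h6 : -x + (t - 1) = -(x - t) + -1 := by ring
    rw [h6, val_compl, val_sub_formula]
    split_ifs <;> omega
  rw [e1, e4, val_sub_formula]
  split_ifs <;> omega

theorem xor_aux (a1 b1 a2 b2 fa fb gx gy : Prop)
    (h : ((a1 ↔ ¬ (fa ↔ gx)) ↔ (b1 ↔ ¬ (fb ↔ gx))) ↔ ((a2 ↔ ¬ (fa ↔ gy)) ↔ (b2 ↔ ¬ (fb ↔ gy)))) :
    (a1 ↔ b1) ↔ (a2 ↔ b2) := by
  by_cases h1 : fa <;> by_cases h2 : fb <;> by_cases h3 : gx <;> by_cases h4 : gy <;>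
    by_cases h5 : a1 <;> by_cases h6 : b1 <;> by_cases h7 : a2 <;> by_cases h8 : b2 <;> simp_all

theorem krew_mem {L : ℕ} [NeZero L] (t : ZMod L) (P : NCPart L) (hP : P ∈ Fx L t) :
    Krew P ∈ Fx L (t - 1) := by
  have key : ∀ x y, (Krew P).1.r x y → (Krew P).1.r (-x + (t - 1)) (-y + (t - 1)) := by
    intro x y h a b hab
    have h1 := h _ _ ((hP a b).1 hab)
    rw [refl_cut, refl_cut, refl_cut, refl_cut] at h1
    exact xor_aux _ _ _ _ _ _ _ _ h1
  intro x y
  refine ⟨key x y, fun h => ?_⟩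
  have := key _ _ h
  have e : ∀ x : ZMod L, -(-x + (t - 1)) + (t - 1) = x := by intro x; ring
  rwa [e, e] at this

theorem val_natCast_lt {L : ℕ} [NeZero L] {n : ℕ} (h : n < L) : ((n : ZMod L)).val = n :=
  ZMod.val_cast_of_lt h

theorem krew_sep {L : ℕ} [NeZero L] (Q : NCPart L) (x y : ZMod L) (hxy : ¬ Q.1.r x y)
    (hlt : x.val < y.val) : ∃ u v : ZMod L, (Krew Q).1.r u v ∧
      ¬ ((x.val ≤ u.val ↔ y.val ≤ u.val) ↔ (x.val ≤ v.val ↔ y.val ≤ v.val)) := by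
  classical
  have hnc := (isNC_iff Q.1).1 Q.2
  obtain ⟨u, hu, humax⟩ := Finset.exists_max_image
    (Finset.univ.filter (fun z : ZMod L => Q.1.r x z ∧ z.val < y.val)) ZMod.val
    ⟨x, by simpa using hlt⟩
  simp only [Finset.mem_filter, Finset.mem_univ, true_and] at hu humax
  have hxu := humax x ⟨Q.1.refl' x, hlt⟩
  have hyL := ZMod.val_lt y
  by_cases hv : ∃ v, Q.1.r x v ∧ y.val < v.val
  · obtain ⟨v, hv, hvmin⟩ := Finset.exists_min_image
      (Finset.univ.filter (fun z : ZMod L => Q.1.r x z ∧ y.val < z.val)) ZMod.val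
      (by obtain ⟨v, hv⟩ := hv; exact ⟨v, by simpa using hv⟩)
    simp only [Finset.mem_filter, Finset.mem_univ, true_and] at hv hvmin
    have hvL := ZMod.val_lt v
    have hv1 : (((v.val - 1 : ℕ) : ZMod L)).val = v.val - 1 := val_natCast_lt (by omega)
    refine ⟨u, ((v.val - 1 : ℕ) : ZMod L), ?_, by rw [hv1]; omega⟩
    have huv : Q.1.r u v := Q.1.trans' (Q.1.symm' hu.1) hv.1
    -- elements strictly between are not in the block
    have hout : ∀ p : ZMod L, u.val < p.val → p.val < v.val → ¬ Q.1.r x p := by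
      intro p h1 h2 hp
      rcases lt_trichotomy p.val y.val with h | h | h
      · have := humax p ⟨hp, h⟩; omega
      · rw [ZMod.val_injective L h] at hp; exact hxy hp
      · have := hvmin p ⟨hp, h⟩; omega
    have hcl : ∀ p q : ZMod L, Q.1.r p q → u.val < p.val → p.val < v.val →
        u.val < q.val ∧ q.val < v.val := by
      intro p q hpq h1 h2
      by_contra hq
      have hp := hout p h1 h2
      rcases lt_trichotomy q.val u.val with h | h | h
      · exact hp (Q.1.trans' hu.1 (Q.1.trans' (Q.1.symm' (hnc q u p v h h1 h2 (Q.1.symm' hpq) huv))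
          (Q.1.symm' hpq)))
      · rw [ZMod.val_injective L h] at hpq; exact hp (Q.1.trans' hu.1 (Q.1.symm' hpq))
      · rcases lt_trichotomy v.val q.val with h' | h' | h'
        · exact hp (Q.1.trans' hu.1 (hnc u p v q h1 h2 h' huv hpq))
        · rw [← ZMod.val_injective L h'] at hpq; exact hp (Q.1.trans' hv.1 (Q.1.symm' hpq))
        · omega
    intro p q hpq
    have c1 := hcl p q hpq
    have c2 := hcl q p (Q.1.symm' hpq)
    rw [hv1]
    omega
  · obtain ⟨m, hm, hmmin⟩ := Finset.exists_min_image
      (Finset.univ.filter (fun z : ZMod L => Q.1.r x z)) ZMod.val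
      ⟨x, by simp⟩
    simp only [Finset.mem_filter, Finset.mem_univ, true_and] at hm hmmin
    have hmx := hmmin x (Q.1.refl' x)
    have hmu : Q.1.r m u := Q.1.trans' (Q.1.symm' hm) hu.1
    have hout : ∀ p : ZMod L, (u.val < p.val ∨ p.val < m.val) → ¬ Q.1.r x p := by
      intro p h1 hp
      have := hmmin p hp
      rcases lt_trichotomy p.val y.val with h | h | h
      · have := humax p ⟨hp, h⟩; omega
      · rw [ZMod.val_injective L h] at hp; exact hxy hp
      · exact hv ⟨p, hp, h⟩
    have hcl : ∀ p q : ZMod L, Q.1.r p q → (u.val < p.val ∨ p.val < m.val) →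
        (u.val < q.val ∨ q.val < m.val) := by
      intro p q hpq h1
      by_contra hq
      have hp := hout p h1
      have hqp := Q.1.symm' hpq
      have hq' : ¬ Q.1.r x q := fun h => hp (Q.1.trans' h hqp)
      have n1 : q.val ≠ u.val := fun h => hq' (by rw [ZMod.val_injective L h]; exact hu.1)
      have n2 : q.val ≠ m.val := fun h => hq' (by rw [ZMod.val_injective L h]; exact hm)
      rcases h1 with h1 | h1
      · exact hq' (Q.1.trans' hm (hnc m q u p (by omega) (by omega) h1 hmu hqp))
      · exact hp (Q.1.trans' hm (Q.1.symm' (hnc p m q u h1 (by omega) (by omega) hpq hmu)))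
    rcases Nat.eq_zero_or_pos m.val with h0 | h0
    · have hv1 : (-1 : ZMod L).val = L - 1 := val_neg_one_formula
      refine ⟨u, -1, ?_, by rw [hv1]; omega⟩
      intro p q hpq
      have c1 := hcl p q hpq
      have c2 := hcl q p (Q.1.symm' hpq)
      have := ZMod.val_lt p
      have := ZMod.val_lt q
      rw [hv1]
      omega
    · have hv1 : (((m.val - 1 : ℕ) : ZMod L)).val = m.val - 1 := val_natCast_lt (by omega)
      refine ⟨u, ((m.val - 1 : ℕ) : ZMod L), ?_, by rw [hv1]; omega⟩
      intro p q hpq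
      have c1 := hcl p q hpq
      have c2 := hcl q p (Q.1.symm' hpq)
      rw [hv1]
      omega

theorem krew_le {L : ℕ} [NeZero L] (P Q : NCPart L) (h : Krew P = Krew Q) (x y : ZMod L)
    (hxy : P.1.r x y) : Q.1.r x y := by
  by_contra hq
  have main : ∀ x y : ZMod L, P.1.r x y → ¬ Q.1.r x y → x.val < y.val → False := by
    intro x y hxy hq hlt
    obtain ⟨u, v, h1, h2⟩ := krew_sep Q x y hq hlt
    rw [← h] at h1
    exact h2 (h1 x y hxy)
  rcases lt_trichotomy x.val y.val with h1 | h1 | h1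
  · exact main x y hxy hq h1
  · rw [ZMod.val_injective L h1] at hq; exact hq (Q.1.refl' y)
  · exact main y x (P.1.symm' hxy) (fun h => hq (Q.1.symm' h)) h1

theorem krew_inj {L : ℕ} [NeZero L] : Function.Injective (Krew (L := L)) := fun P Q h =>
  NCPart_ext fun x y => ⟨krew_le P Q h x y, krew_le Q P h.symm x y⟩

theorem card_Fx_le {L : ℕ} [NeZero L] (t : ZMod L) (n : ℕ) :
    Nat.card (Fx L t) ≤ Nat.card (Fx L (t - n)) := by
  induction n with
  | zero => simp
  | succ n ih =>
    refine ih.trans ?_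
    have e : t - ((n + 1 : ℕ) : ZMod L) = t - n - 1 := by push_cast; ring
    rw [e]
    apply Nat.card_le_card_of_injective
      (fun P : Fx L (t - n) => (⟨Krew P.1, krew_mem _ _ P.2⟩ : Fx L (t - n - 1)))
    intro P Q h
    exact Subtype.ext (krew_inj (congrArg Subtype.val h))

theorem card_Fx_eq {L : ℕ} [NeZero L] (t s : ZMod L) :
    Nat.card (Fx L t) = Nat.card (Fx L s) := by
  have : ∀ t s : ZMod L, Nat.card (Fx L t) ≤ Nat.card (Fx L s) := by
    intro t s
    have := card_Fx_le t (t - s).val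
    rwa [ZMod.natCast_zmod_val, sub_sub_cancel] at this
  exact le_antisymm (this t s) (this s t)

/-- Extend a finite word by `false`. -/
def wext {n : ℕ} (w : Fin n → Bool) (i : ℕ) : Bool := if h : i < n then w ⟨i, h⟩ else false

/-- Height of the path with steps `w`. -/
def hgt (w : ℕ → Bool) (k : ℕ) : ℤ := ∑ i ∈ Finset.range k, if w i then 1 else -1

/-- Words whose path started at height `h` stays non-negative. -/
def Ok (n : ℕ) (h : ℤ) : Set (Fin n → Bool) := {w | ∀ k ≤ n, 0 ≤ h + hgt (wext w) k}

theorem hgt_succ (w : ℕ → Bool) (k : ℕ) : hgt w (k + 1) = hgt w k + if w k then 1 else -1 := by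
  simp [hgt, Finset.sum_range_succ]

theorem hgt_zero (w : ℕ → Bool) : hgt w 0 = 0 := by simp [hgt]

theorem hgt_cons {n : ℕ} (b : Bool) (w : Fin n → Bool) (k : ℕ) :
    hgt (wext (Fin.cons b w : Fin (n + 1) → Bool)) (k + 1) =
      (if b then 1 else -1) + hgt (wext w) k := by
  have h0 : wext (Fin.cons b w : Fin (n + 1) → Bool) 0 = b := by simp [wext]
  have h1 : ∀ i, wext (Fin.cons b w : Fin (n + 1) → Bool) (i + 1) = wext w i := by
    intro i
    by_cases h : i < n
    · have h' : i + 1 < n + 1 := by omega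
      simp only [wext, h, h', dif_pos]
      exact Fin.cons_succ (α := fun _ => Bool) b w ⟨i, h⟩
    · simp [wext, h]
  simp only [hgt, Finset.sum_range_succ', h0, h1]
  ring

theorem ok_cons {n : ℕ} (b : Bool) (w : Fin n → Bool) (h : ℤ) (hh : 0 ≤ h) :
    (Fin.cons b w : Fin (n + 1) → Bool) ∈ Ok (n + 1) h ↔
      w ∈ Ok n (h + if b then 1 else -1) := by
  constructor
  · intro H k hk
    have := H (k + 1) (by omega)
    rw [hgt_cons] at this
    linarith
  · intro H k hk
    cases k with
    | zero => rw [hgt_zero]; omega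
    | succ k =>
      have := H k (by omega)
      rw [hgt_cons]
      linarith

theorem card_ok_succ (n : ℕ) (h : ℤ) (hh : 0 ≤ h) :
    Nat.card (Ok (n + 1) h) = Nat.card (Ok n (h + 1)) + Nat.card (Ok n (h - 1)) := by
  rw [← Nat.card_sum]
  symm
  let f : (Ok n (h + 1)) ⊕ (Ok n (h - 1)) → Ok (n + 1) h := Sum.elim
    (fun w => ⟨Fin.cons true w.1, (ok_cons true w.1 h hh).2 (by simpa using w.2)⟩)
    (fun w => ⟨Fin.cons false w.1, (ok_cons false w.1 h hh).2 (by simpa [sub_eq_add_neg] using w.2)⟩)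
  apply Nat.card_eq_of_bijective f
  constructor
  · rintro (a | a) (b | b) hab
    · have := congrArg Subtype.val hab
      simp only [f, Sum.elim_inl] at this
      rw [Fin.cons_inj] at this
      exact congrArg Sum.inl (Subtype.ext this.2)
    · have := congrArg Subtype.val hab
      simp only [f, Sum.elim_inl, Sum.elim_inr] at this
      rw [Fin.cons_inj] at this
      simp at this
    · have := congrArg Subtype.val hab
      simp only [f, Sum.elim_inl, Sum.elim_inr] at this
      rw [Fin.cons_inj] at this
      simp at this
    · have := congrArg Subtype.val hab
      simp only [f, Sum.elim_inr] at this
      rw [Fin.cons_inj] at this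
      exact congrArg Sum.inr (Subtype.ext this.2)
  · rintro ⟨w, hw⟩
    obtain ⟨b, v, rfl⟩ : ∃ b v, w = (Fin.cons b v : Fin (n + 1) → Bool) :=
      ⟨w 0, Fin.tail w, (Fin.cons_self_tail w).symm⟩
    have hv := (ok_cons b v h hh).1 hw
    cases b
    · exact ⟨Sum.inr ⟨v, by simpa [sub_eq_add_neg] using hv⟩, rfl⟩
    · exact ⟨Sum.inl ⟨v, by simpa using hv⟩, rfl⟩

def GG (n : ℕ) (h : ℤ) : ℕ := ∑ k ∈ Finset.range (n + 1),
  if -h ≤ (n : ℤ) - 2 * k ∧ (n : ℤ) - 2 * k ≤ h + 1 then n.choose k else 0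

theorem GG_succ (n : ℕ) (h : ℤ) (hh : 0 ≤ h) : GG (n + 1) h = GG n (h + 1) + GG n (h - 1) := by
  have e : ∀ I : ℕ → Prop, ∀ _ : DecidablePred I,
      ∑ k ∈ Finset.range (n + 1 + 1), (if I k then (n + 1).choose k else 0) =
      ∑ k ∈ Finset.range (n + 1), ((if I k then n.choose k else 0) +
        (if I (k + 1) then n.choose k else 0)) := by
    intro I _
    have e1 : ∑ k ∈ Finset.range (n + 1), (if I k then n.choose k else 0) =
        ∑ k ∈ Finset.range (n + 1), (if I (k + 1) then n.choose (k + 1) else 0) +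
          (if I 0 then 1 else 0) := by
      have := Finset.sum_range_succ' (fun k => if I k then n.choose k else 0) (n + 1)
      rw [Finset.sum_range_succ] at this
      simpa using this
    rw [Finset.sum_add_distrib, e1, Finset.sum_range_succ', add_right_comm, ← Finset.sum_add_distrib]
    congr 1
    apply Finset.sum_congr rfl
    intro k _
    rw [Nat.choose_succ_succ]
    split_ifs <;> simp [add_comm]
  unfold GG
  rw [e (fun k => -h ≤ ((n + 1 : ℕ) : ℤ) - 2 * k ∧ ((n + 1 : ℕ) : ℤ) - 2 * k ≤ h + 1),
    ← Finset.sum_add_distrib]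
  apply Finset.sum_congr rfl
  intro k _
  push_cast
  split_ifs <;> first | omega | rfl

theorem card_ok (n : ℕ) : ∀ h : ℤ, -1 ≤ h → Nat.card (Ok n h) = GG n h := by
  have neg : ∀ n, Nat.card (Ok n (-1)) = GG n (-1) := by
    intro n
    have : IsEmpty (Ok n (-1)) := ⟨fun w => by
      have := w.2 0 (by omega)
      rw [hgt_zero] at this
      omega⟩
    rw [Nat.card_of_isEmpty]
    symm
    apply Finset.sum_eq_zero
    intro k _
    rw [if_neg]
    omega
  induction n with
  | zero =>
    intro h hh
    rcases eq_or_lt_of_le hh with rfl | hh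
    · exact neg 0
    · have h1 : Ok 0 h = Set.univ := by
        ext w
        simp only [Ok, Set.mem_ofPred_eq, Set.mem_univ, iff_true]
        intro k hk
        obtain rfl : k = 0 := by omega
        rw [hgt_zero]; omega
      rw [h1]
      simp only [Nat.card_univ, GG]
      simp
      omega
  | succ n ih =>
    intro h hh
    rcases eq_or_lt_of_le hh with rfl | hh
    · exact neg _
    · rw [card_ok_succ n h (by omega), GG_succ n h (by omega), ih _ (by omega), ih _ (by omega)]

theorem card_ok_zero (n : ℕ) : Nat.card (Ok n 0) = n.choose (n / 2) := by
  rw [card_ok n 0 (by omega), GG, Finset.sum_eq_single (n / 2)]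
  · rw [if_pos]; omega
  · intro k _ hk
    rw [if_neg]; omega
  · intro h
    simp at h; omega

/-- Contour equivalence of a height function. -/
def conR (H : ℕ → ℤ) : Setoid ℕ where
  r s t := H s = H t ∧ ∀ u, (s ≤ u ∧ u ≤ t ∨ t ≤ u ∧ u ≤ s) → H s ≤ H u
  iseqv := by
    refine ⟨fun s => ⟨rfl, fun u hu => ?_⟩, fun {s t} h => ⟨h.1.symm, fun u hu => ?_⟩,
      fun {s t r} h1 h2 => ⟨h1.1.trans h2.1, fun u hu => ?_⟩⟩
    · obtain rfl : u = s := by omega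
      exact le_refl _
    · rw [← h.1]; exact h.2 u (by omega)
    · by_cases hc : s ≤ u ∧ u ≤ t ∨ t ≤ u ∧ u ≤ s
      · exact h1.2 u hc
      · rw [h1.1]; exact h2.2 u (by omega)

theorem conR_iff (H : ℕ → ℤ) (s t : ℕ) : (conR H).r s t ↔
    H s = H t ∧ ∀ u, (s ≤ u ∧ u ≤ t ∨ t ≤ u ∧ u ≤ s) → H s ≤ H u := Iff.rfl

/-- Symmetrized height. -/
def Hs (L : ℕ) (w : ℕ → Bool) (s : ℕ) : ℤ := hgt w (min s (2 * L - s))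

theorem Hs_symm (L : ℕ) (w : ℕ → Bool) (s : ℕ) (h : s ≤ 2 * L) : Hs L w (2 * L - s) = Hs L w s := by
  unfold Hs
  congr 1
  omega

theorem Hs_left (L : ℕ) (w : ℕ → Bool) (s : ℕ) (h : s ≤ L) : Hs L w s = hgt w s := by
  unfold Hs
  congr 1
  omega

theorem hgt_parity (w : ℕ → Bool) (k : ℕ) : hgt w k % 2 = (k : ℤ) % 2 := by
  induction k with
  | zero => simp [hgt]
  | succ k ih => rw [hgt_succ]; push_cast; split_ifs <;> omega

theorem Hs_parity (L : ℕ) (w : ℕ → Bool) (s : ℕ) (h : s ≤ 2 * L) :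
    Hs L w s % 2 = (s : ℤ) % 2 := by
  unfold Hs
  rw [hgt_parity]
  omega

theorem Hs_step (L : ℕ) (w : ℕ → Bool) (s : ℕ) (h : s < 2 * L) :
    Hs L w (s + 1) = Hs L w s + 1 ∨ Hs L w (s + 1) = Hs L w s - 1 := by
  unfold Hs
  by_cases hs : s + 1 ≤ L
  · rw [show min (s + 1) (2 * L - (s + 1)) = s + 1 by omega, show min s (2 * L - s) = s by omega,
      hgt_succ]
    split_ifs <;> omega
  · rw [show min (s + 1) (2 * L - (s + 1)) = 2 * L - s - 1 by omega,
      show min s (2 * L - s) = (2 * L - s - 1) + 1 by omega, hgt_succ]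
    split_ifs <;> omega

theorem ivt_last (f : ℕ → ℤ) (c : ℤ) (b : ℕ) (hstep : ∀ s < b, f (s + 1) ≤ f s + 1)
    (h0 : f 0 ≤ c) (hb : c < f b) : ∃ s < b, f s = c ∧ ∀ u, s < u → u ≤ b → c < f u := by
  induction b with
  | zero => omega
  | succ b ih =>
    by_cases hc : c < f b
    · obtain ⟨s, h1, h2, h3⟩ := ih (fun s hs => hstep s (by omega)) hc
      refine ⟨s, by omega, h2, fun u hu hub => ?_⟩
      rcases Nat.lt_or_ge b u with h | h
      · rwa [show u = b + 1 by omega]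
      · exact h3 u hu h
    · have := hstep b (by omega)
      refine ⟨b, by omega, by omega, fun u hu hub => ?_⟩
      rwa [show u = b + 1 by omega]

theorem Hs_nonneg {L : ℕ} {w : Fin L → Bool} (hw : w ∈ Ok L 0) (s : ℕ) : 0 ≤ Hs L (wext w) s := by
  have := hw (min s (2 * L - s)) (by omega)
  unfold Hs
  linarith

theorem con_min {L : ℕ} {w : Fin L → Bool} (hw : w ∈ Ok L 0) (x : ℕ) (hx : x < L) :
    (∃ y < x, (conR (Hs L (wext w))).r (2 * y + 1) (2 * x + 1)) ↔
      Hs L (wext w) (2 * x + 1) < Hs L (wext w) (2 * x) := by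
  constructor
  · rintro ⟨y, hy, h1, h2⟩
    have := h2 (2 * x) (by omega)
    have := Hs_step L (wext w) (2 * x) (by omega)
    omega
  · intro h
    obtain ⟨s, hs, h1, h2⟩ := ivt_last (Hs L (wext w)) (Hs L (wext w) (2 * x + 1)) (2 * x)
      (fun s hs => by have := Hs_step L (wext w) s (by omega); omega)
      (by
        have := Hs_nonneg hw (2 * x + 1)
        rw [Hs_left _ _ 0 (by omega), hgt_zero]
        exact this) h
    have p1 := Hs_parity L (wext w) s (by omega)
    have p2 := Hs_parity L (wext w) (2 * x + 1) (by omega)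
    have hodd : s % 2 = 1 := by
      rw [h1, p2] at p1
      omega
    refine ⟨s / 2, by omega, ?_⟩
    rw [show 2 * (s / 2) + 1 = s by omega]
    refine ⟨h1, fun u hu => ?_⟩
    rw [h1]
    by_cases hus : u = s
    · rw [hus, h1]
    · by_cases hux : u = 2 * x + 1
      · rw [hux]
      · exact (h2 u (by omega) (by omega)).le

theorem con_symm {L : ℕ} (w : ℕ → Bool) (s t : ℕ) (hs : s ≤ 2 * L) (ht : t ≤ 2 * L)
    (h : (conR (Hs L w)).r s t) : (conR (Hs L w)).r (2 * L - s) (2 * L - t) := by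
  refine ⟨by rw [Hs_symm _ _ _ hs, Hs_symm _ _ _ ht]; exact h.1, fun u hu => ?_⟩
  rw [Hs_symm _ _ _ hs, ← Hs_symm _ _ u (by omega)]
  exact h.2 _ (by omega)

theorem con_max {L : ℕ} {w : Fin L → Bool} (hw : w ∈ Ok L 0) (x : ℕ) (hx : x < L) :
    (∃ y, x < y ∧ y < L ∧ (conR (Hs L (wext w))).r (2 * y + 1) (2 * x + 1)) ↔
      Hs L (wext w) (2 * x + 1) < Hs L (wext w) (2 * x + 2) := by
  have h := con_min hw (L - 1 - x) (by omega)
  rw [← Hs_symm L _ (2 * x + 1) (by omega), ← Hs_symm L _ (2 * x + 2) (by omega),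
    show 2 * L - (2 * x + 1) = 2 * (L - 1 - x) + 1 by omega,
    show 2 * L - (2 * x + 2) = 2 * (L - 1 - x) by omega, ← h]
  constructor
  · rintro ⟨y, h1, h2, h3⟩
    refine ⟨L - 1 - y, by omega, ?_⟩
    have := con_symm _ _ _ (by omega) (by omega) h3
    rwa [show 2 * L - (2 * x + 1) = 2 * (L - 1 - x) + 1 by omega,
      show 2 * L - (2 * y + 1) = 2 * (L - 1 - y) + 1 by omega] at this
  · rintro ⟨y, h1, h3⟩
    refine ⟨L - 1 - y, by omega, by omega, ?_⟩
    have := con_symm _ _ _ (by omega) (by omega) h3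
    rwa [show 2 * L - (2 * (L - 1 - x) + 1) = 2 * x + 1 by omega,
      show 2 * L - (2 * y + 1) = 2 * (L - 1 - y) + 1 by omega] at this

/-- The partition attached to a word. -/
def phi {L : ℕ} [NeZero L] (w : Fin L → Bool) : NCPart L :=
  ⟨(conR (Hs L (wext w))).comap (fun x : ZMod L => 2 * x.val + 1), by
    rw [isNC_iff]
    intro a b c d h1 h2 h3 hac hbd
    have hac' : (conR (Hs L (wext w))).r (2 * a.val + 1) (2 * c.val + 1) := hac
    have hbd' : (conR (Hs L (wext w))).r (2 * b.val + 1) (2 * d.val + 1) := hbd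
    obtain ⟨e1, f1⟩ := hac'
    obtain ⟨e2, f2⟩ := hbd'
    have g1 := f1 (2 * b.val + 1) (by omega)
    have g2 := f2 (2 * c.val + 1) (by omega)
    have g3 : Hs L (wext w) (2 * a.val + 1) = Hs L (wext w) (2 * b.val + 1) := by
      change Hs L (wext w) (2 * a.val + 1) = Hs L (wext w) (2 * c.val + 1) at e1
      change Hs L (wext w) (2 * a.val + 1) ≤ Hs L (wext w) (2 * b.val + 1) at g1
      change Hs L (wext w) (2 * b.val + 1) ≤ Hs L (wext w) (2 * c.val + 1) at g2
      omega
    exact ⟨g3, fun u hu => f1 u (by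
      change 2 * a.val + 1 ≤ u ∧ u ≤ 2 * b.val + 1 ∨ 2 * b.val + 1 ≤ u ∧ u ≤ 2 * a.val + 1 at hu
      change 2 * a.val + 1 ≤ u ∧ u ≤ 2 * c.val + 1 ∨ 2 * c.val + 1 ≤ u ∧ u ≤ 2 * a.val + 1
      omega)⟩⟩

theorem phi_r {L : ℕ} [NeZero L] (w : Fin L → Bool) (x y : ZMod L) :
    (phi w).1.r x y ↔ (conR (Hs L (wext w))).r (2 * x.val + 1) (2 * y.val + 1) := Iff.rfl

theorem phi_nat {L : ℕ} [NeZero L] (w : Fin L → Bool) (x y : ℕ) (hx : x < L) (hy : y < L) :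
    (phi w).1.r (x : ZMod L) (y : ZMod L) ↔
      (conR (Hs L (wext w))).r (2 * x + 1) (2 * y + 1) := by
  rw [phi_r, val_natCast_lt hx, val_natCast_lt hy]

theorem phi_mem {L : ℕ} [NeZero L] (w : Fin L → Bool) : phi w ∈ Fx L (-1) := by
  have key : ∀ x y : ZMod L, (phi w).1.r x y → (phi w).1.r (-x + -1) (-y + -1) := by
    intro x y h
    have hx := ZMod.val_lt x
    have hy := ZMod.val_lt y
    have := con_symm _ _ _ (by omega) (by omega) ((phi_r w x y).1 h)
    rw [phi_r, val_compl, val_compl]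
    rwa [show 2 * L - (2 * x.val + 1) = 2 * (L - 1 - x.val) + 1 by omega,
      show 2 * L - (2 * y.val + 1) = 2 * (L - 1 - y.val) + 1 by omega] at this
  intro x y
  refine ⟨key x y, fun h => ?_⟩
  have := key _ _ h
  have e : ∀ x : ZMod L, -(-x + -1) + -1 = x := by intro x; ring
  rwa [e, e] at this

theorem wext_even {L : ℕ} [NeZero L] {w : Fin L → Bool} (hw : w ∈ Ok L 0) (x : ℕ)
    (hx : 2 * x < L) : wext w (2 * x) = true ↔
      ¬ ∃ y < x, (phi w).1.r (y : ZMod L) (x : ZMod L) := by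
  have h := con_min hw x (by omega)
  rw [Hs_left _ _ (2 * x + 1) (by omega), Hs_left _ _ (2 * x) (by omega), hgt_succ] at h
  have : (∃ y < x, (phi w).1.r (y : ZMod L) (x : ZMod L)) ↔
      (∃ y < x, (conR (Hs L (wext w))).r (2 * y + 1) (2 * x + 1)) :=
    exists_congr fun y => and_congr_right fun hy => phi_nat w y x (by omega) (by omega)
  rw [this, h]
  split_ifs with h1 <;> simp [h1]

theorem wext_odd {L : ℕ} [NeZero L] {w : Fin L → Bool} (hw : w ∈ Ok L 0) (x : ℕ)
    (hx : 2 * x + 1 < L) : wext w (2 * x + 1) = true ↔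
      ∃ y, x < y ∧ y < L ∧ (phi w).1.r (y : ZMod L) (x : ZMod L) := by
  have h := con_max hw x (by omega)
  rw [Hs_left _ _ (2 * x + 1) (by omega), Hs_left _ _ (2 * x + 2) (by omega), hgt_succ (wext w) (2 * x + 1)] at h
  have : (∃ y, x < y ∧ y < L ∧ (phi w).1.r (y : ZMod L) (x : ZMod L)) ↔
      (∃ y, x < y ∧ y < L ∧ (conR (Hs L (wext w))).r (2 * y + 1) (2 * x + 1)) :=
    exists_congr fun y => and_congr_right fun _ => and_congr_right fun hy =>
      phi_nat w y x (by omega) (by omega)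
  rw [this, h]
  split_ifs with h1 <;> simp [h1]

theorem phi_inj {L : ℕ} [NeZero L] {w v : Fin L → Bool} (hw : w ∈ Ok L 0) (hv : v ∈ Ok L 0)
    (h : phi w = phi v) : w = v := by
  funext ⟨j, hj⟩
  have e : wext w j = wext v j := by
    rw [Bool.eq_iff_iff]
    rcases Nat.even_or_odd' j with ⟨x, rfl | rfl⟩
    · rw [wext_even hw x hj, wext_even hv x hj, h]
    · rw [wext_odd hw x hj, wext_odd hv x hj, h]
  simpa [wext, hj] using e

/-- The partition as a relation on natural numbers. -/
def RN {L : ℕ} (P : NCPart L) (a b : ℕ) : Prop := P.1.r (a : ZMod L) (b : ZMod L)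

theorem RN_refl {L : ℕ} (P : NCPart L) (a : ℕ) : RN P a a := P.1.refl' _
theorem RN_symm {L : ℕ} {P : NCPart L} {a b : ℕ} (h : RN P a b) : RN P b a := P.1.symm' h
theorem RN_trans {L : ℕ} {P : NCPart L} {a b c : ℕ} (h : RN P a b) (h' : RN P b c) : RN P a c :=
  P.1.trans' h h'

theorem RN_nc {L : ℕ} [NeZero L] (P : NCPart L) (a b c d : ℕ) (h1 : a < b) (h2 : b < c)
    (h3 : c < d) (h4 : d < L) (hac : RN P a c) (hbd : RN P b d) : RN P a b := by
  apply (isNC_iff P.1).1 P.2 _ _ (c : ZMod L) (d : ZMod L) _ _ _ hac hbd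
  · rwa [val_natCast_lt (by omega), val_natCast_lt (by omega)]
  · rwa [val_natCast_lt (by omega), val_natCast_lt (by omega)]
  · rwa [val_natCast_lt (by omega), val_natCast_lt (by omega)]

def isMn {L : ℕ} (P : NCPart L) (x : ℕ) : Prop := ∀ z < x, ¬ RN P z x
def isMx {L : ℕ} (P : NCPart L) (x : ℕ) : Prop := ∀ z, x < z → z < L → ¬ RN P z x

open Classical in
/-- The word attached to a partition. -/
noncomputable def psi {L : ℕ} (P : NCPart L) (j : Fin L) : Bool :=
  if j.1 % 2 = 0 then decide (isMn P (j.1 / 2)) else decide (¬ isMx P (j.1 / 2))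

theorem psi_even {L : ℕ} (P : NCPart L) (x : ℕ) (hx : 2 * x < L) :
    wext (psi P) (2 * x) = true ↔ isMn P x := by
  simp [wext, psi, hx]

theorem psi_odd {L : ℕ} (P : NCPart L) (x : ℕ) (hx : 2 * x + 1 < L) :
    wext (psi P) (2 * x + 1) = true ↔ ¬ isMx P x := by
  have h1 : (2 * x + 1) % 2 = 1 := by omega
  have h2 : (2 * x + 1) / 2 = x := by omega
  simp [wext, psi, hx, h1, h2]

open Classical in
theorem psi_count {L : ℕ} (P : NCPart L) (x : ℕ) (hx : 2 * x ≤ L) :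
    hgt (wext (psi P)) (2 * x) = 2 * (((Finset.range x).filter (isMn P)).card : ℤ)
      - 2 * (((Finset.range x).filter (isMx P)).card : ℤ) := by
  induction x with
  | zero => simp [hgt]
  | succ x ih =>
    rw [show 2 * (x + 1) = 2 * x + 1 + 1 by ring, hgt_succ, hgt_succ, ih (by omega)]
    simp only [psi_even P x (by omega), psi_odd P x (by omega)]
    rw [Finset.range_add_one, Finset.filter_insert, Finset.filter_insert]
    by_cases h1 : isMn P x <;> by_cases h2 : isMx P x <;> simp [h1, h2] <;> ring

open Classical in
theorem mx_le_mn {L : ℕ} (P : NCPart L) (x : ℕ) (hx : x ≤ L) :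
    ((Finset.range x).filter (isMx P)).card + (if x < L ∧ ¬ isMn P x then 1 else 0) ≤
      ((Finset.range x).filter (isMn P)).card := by
  have hex : ∀ y, ∃ z, RN P z y := fun y => ⟨y, RN_refl P y⟩
  let mn : ℕ → ℕ := fun y => Nat.find (hex y)
  have hmn1 : ∀ y, RN P (mn y) y := fun y => Nat.find_spec (hex y)
  have hmn2 : ∀ y z, RN P z y → mn y ≤ z := fun y z h => Nat.find_min' (hex y) h
  have hmn3 : ∀ y, isMn P (mn y) := by
    intro y z hz h
    have := hmn2 y z (RN_trans h (hmn1 y))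
    omega
  have hmaps : ∀ y ∈ (Finset.range x).filter (isMx P), mn y ∈ (Finset.range x).filter (isMn P) := by
    intro y hy
    simp only [Finset.mem_filter, Finset.mem_range] at hy ⊢
    have := hmn2 y y (RN_refl P y)
    exact ⟨by omega, hmn3 y⟩
  have hinj : Set.InjOn mn ((Finset.range x).filter (isMx P) : Finset ℕ) := by
    intro y hy z hz h
    simp only [Finset.coe_filter, Finset.mem_range, Set.mem_ofPred_eq] at hy hz
    have hyz : RN P y z := by
      have h1 := hmn1 y
      rw [h] at h1
      exact RN_trans (RN_symm h1) (hmn1 z)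
    rcases lt_trichotomy y z with h' | h' | h'
    · exact absurd (RN_symm hyz) (hy.2 z h' (by omega))
    · exact h'
    · exact absurd hyz (hz.2 y h' (by omega))
  split_ifs with hc
  · have hm : mn x ∈ (Finset.range x).filter (isMn P) := by
      simp only [Finset.mem_filter, Finset.mem_range]
      refine ⟨?_, hmn3 x⟩
      have h1 := hmn2 x x (RN_refl P x)
      rcases eq_or_lt_of_le h1 with h | h
      · exact absurd (h ▸ hmn3 x) hc.2
      · exact h
    rw [← Finset.card_erase_add_one hm]
    apply Nat.add_le_add_right
    apply Finset.card_le_card_of_injOn mn _ hinj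
    intro y hy
    have := hmaps y hy
    simp only [Finset.coe_erase, Set.mem_sdiff, Finset.mem_coe, Set.mem_singleton_iff]
    refine ⟨this, fun h => ?_⟩
    simp only [Finset.mem_coe, Finset.mem_filter, Finset.mem_range] at hy
    have h1 := hmn1 y
    rw [h] at h1
    exact hy.2 x hy.1 hc.1 (RN_trans (RN_symm (hmn1 x)) h1)
  · exact Finset.card_le_card_of_injOn mn hmaps hinj

theorem psi_ok {L : ℕ} (P : NCPart L) : psi P ∈ Ok L 0 := by
  classical
  intro k hk
  rw [zero_add]
  rcases Nat.even_or_odd' k with ⟨x, rfl | rfl⟩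
  · rw [psi_count P x hk]
    have := mx_le_mn P x (by omega)
    split_ifs at this <;> omega
  · rw [hgt_succ, psi_count P x (by omega)]
    have := mx_le_mn P x (by omega)
    simp only [psi_even P x (by omega)]
    by_cases h : isMn P x
    · simp only [h, if_true, not_true, and_false, if_false] at this ⊢
      omega
    · have hc : x < L ∧ ¬ isMn P x := ⟨by omega, h⟩
      rw [if_pos hc] at this
      rw [if_neg h]
      omega

theorem compl_cast {L : ℕ} (x : ℕ) (hx : x < L) :
    ((L - 1 - x : ℕ) : ZMod L) = -(x : ZMod L) + -1 := by
  have h : (L - 1 - x) + (x + 1) = L := by omega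
  have h2 : (((L - 1 - x) + (x + 1) : ℕ) : ZMod L) = ((L : ℕ) : ZMod L) := by rw [h]
  push_cast at h2
  rw [ZMod.natCast_self] at h2
  linear_combination h2

theorem RN_compl {L : ℕ} {P : NCPart L} (hP : P ∈ Fx L (-1)) (x y : ℕ) (hx : x < L) (hy : y < L) :
    RN P (L - 1 - x) (L - 1 - y) ↔ RN P x y := by
  unfold RN
  rw [compl_cast x hx, compl_cast y hy]
  exact (hP _ _).symm

theorem mn_mx {L : ℕ} {P : NCPart L} (hP : P ∈ Fx L (-1)) (x : ℕ) (hx : x < L) :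
    isMx P x ↔ isMn P (L - 1 - x) := by
  constructor
  · intro h z hz hr
    apply h (L - 1 - z) (by omega) (by omega)
    rw [← RN_compl hP _ _ (by omega) hx, show L - 1 - (L - 1 - z) = z by omega]
    exact hr
  · intro h z hz hzL hr
    exact h (L - 1 - z) (by omega) ((RN_compl hP _ _ hzL hx).2 hr)

theorem psi_det {L : ℕ} {P Q : NCPart L} (hP : P ∈ Fx L (-1)) (hQ : Q ∈ Fx L (-1))
    (h : psi P = psi Q) : (∀ x < L, isMn P x ↔ isMn Q x) ∧ (∀ x < L, isMx P x ↔ isMx Q x) := by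
  have h1 : ∀ x < L, isMn P x ↔ isMn Q x := by
    intro x hx
    by_cases hc : 2 * x < L
    · rw [← psi_even P x hc, ← psi_even Q x hc, h]
    · have a := mn_mx hP (L - 1 - x) (by omega)
      have b := mn_mx hQ (L - 1 - x) (by omega)
      rw [show L - 1 - (L - 1 - x) = x by omega] at a b
      rw [← a, ← b, ← not_iff_not, ← psi_odd P _ (by omega), ← psi_odd Q _ (by omega), h]
  refine ⟨h1, fun x hx => ?_⟩
  rw [mn_mx hP x hx, mn_mx hQ x hx]
  exact h1 _ (by omega)

theorem RN_pred {L : ℕ} (P : NCPart L) (x : ℕ) (h : ¬ isMn P x) :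
    ∃ p < x, RN P p x ∧ ∀ z, p < z → z < x → ¬ RN P z x := by
  classical
  unfold isMn at h
  push Not at h
  obtain ⟨z, hz, hr⟩ := h
  obtain ⟨p, hp, hmax⟩ := Finset.exists_max_image
    ((Finset.range x).filter (fun z => RN P z x)) id ⟨z, by simp [hz, hr]⟩
  simp only [Finset.mem_filter, Finset.mem_range, id] at hp hmax
  exact ⟨p, hp.1, hp.2, fun z h1 h2 h3 => by have := hmax z ⟨h2, h3⟩; omega⟩

/-- If the predecessor in `P` were smaller than that in `Q`, contradiction. -/
theorem pred_aux {L : ℕ} [NeZero L] {P Q : NCPart L} (hx2 : ∀ x < L, isMx P x ↔ isMx Q x) (x : ℕ)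
    (hx : x < L) (ih : ∀ a b, a < x → b < x → (RN P a b ↔ RN Q a b)) (p q : ℕ)
    (hpq : p < q) (hq : q < x) (hp1 : RN P p x) (hp2 : ∀ z, p < z → z < x → ¬ RN P z x)
    (hq1 : RN Q q x) : False := by
  classical
  obtain ⟨m, hm, hmax⟩ := Finset.exists_max_image
    ((Finset.range L).filter (fun z => RN P z q)) id ⟨q, by simp [RN_refl]; omega⟩
  simp only [Finset.mem_filter, Finset.mem_range, id] at hm hmax
  have hqm := hmax q ⟨by omega, RN_refl P q⟩
  have hnq := hp2 q hpq hq
  have hmx : m < x := by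
    by_contra hc
    have hne : m ≠ x := fun h => hnq (RN_symm (h ▸ hm.2))
    have := RN_nc P p q x m hpq hq (by omega) hm.1 hp1 (RN_symm hm.2)
    exact hnq (RN_trans (RN_symm this) hp1)
  have hmP : isMx P m := by
    intro z hz hzL hr
    have := hmax z ⟨hzL, RN_trans hr hm.2⟩
    omega
  have hmQ := (hx2 m hm.1).1 hmP
  have hmq : RN Q m q := (ih m q hmx hq).1 hm.2
  exact hmQ x hmx hx (RN_symm (RN_trans hmq hq1))

theorem RN_agree {L : ℕ} [NeZero L] {P Q : NCPart L} (h1 : ∀ x < L, isMn P x ↔ isMn Q x)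
    (h2 : ∀ x < L, isMx P x ↔ isMx Q x) (n : ℕ) (hn : n ≤ L) :
    ∀ a b, a < n → b < n → (RN P a b ↔ RN Q a b) := by
  induction n with
  | zero => intro a b ha; omega
  | succ x ih =>
    have ih := ih (by omega)
    have key : ∀ y < x, RN P y x ↔ RN Q y x := by
      intro y hy
      by_cases hm : isMn P x
      · exact iff_of_false (hm y hy) ((h1 x (by omega)).1 hm y hy)
      · obtain ⟨p, hp, hp1, hp2⟩ := RN_pred P x hm
        obtain ⟨q, hq, hq1, hq2⟩ := RN_pred Q x (fun h => hm ((h1 x (by omega)).2 h))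
        rcases lt_trichotomy p q with h | h | h
        · exact (pred_aux h2 x (by omega) ih p q h hq hp1 hp2 hq1).elim
        · subst h
          have := ih y p hy hp
          exact ⟨fun h => RN_trans (this.1 (RN_trans h (RN_symm hp1))) hq1,
            fun h => RN_trans (this.2 (RN_trans h (RN_symm hq1))) hp1⟩
        · exact (pred_aux (fun x hx => (h2 x hx).symm) x (by omega)
            (fun a b ha hb => (ih a b ha hb).symm) q p h hp hq1 hq2 hp1).elim
    intro a b ha hb
    rcases Nat.lt_or_ge a x with ha' | ha'
    · rcases Nat.lt_or_ge b x with hb' | hb'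
      · exact ih a b ha' hb'
      · obtain rfl : b = x := by omega
        exact key a ha'
    · obtain rfl : a = x := by omega
      rcases Nat.lt_or_ge b a with hb' | hb'
      · exact ⟨fun h => RN_symm ((key b hb').1 (RN_symm h)),
          fun h => RN_symm ((key b hb').2 (RN_symm h))⟩
      · obtain rfl : b = a := by omega
        exact iff_of_true (RN_refl _ _) (RN_refl _ _)

theorem psi_inj {L : ℕ} [NeZero L] {P Q : NCPart L} (hP : P ∈ Fx L (-1)) (hQ : Q ∈ Fx L (-1))
    (h : psi P = psi Q) : P = Q := by
  obtain ⟨h1, h2⟩ := psi_det hP hQ h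
  apply NCPart_ext
  intro x y
  have := RN_agree h1 h2 L le_rfl x.val y.val (ZMod.val_lt x) (ZMod.val_lt y)
  unfold RN at this
  rwa [ZMod.natCast_zmod_val, ZMod.natCast_zmod_val] at this

theorem card_Fx {L : ℕ} [NeZero L] : Nat.card (Fx L (-1)) = L.choose (L / 2) := by
  rw [← card_ok_zero]
  apply le_antisymm
  · apply Nat.card_le_card_of_injective
      (fun P : Fx L (-1) => (⟨psi P.1, psi_ok P.1⟩ : Ok L 0))
    intro P Q h
    exact Subtype.ext (psi_inj P.2 Q.2 (congrArg Subtype.val h))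
  · apply Nat.card_le_card_of_injective
      (fun w : Ok L 0 => (⟨phi w.1, phi_mem w.1⟩ : Fx L (-1)))
    intro w v h
    exact Subtype.ext (phi_inj w.2 v.2 (congrArg Subtype.val h))

/-- Corollary 1: `2·N_D(L) = N_C(L) + binom(L, ⌊L/2⌋)`. -/
theorem two_ND_eq_NC_add_central (L : ℕ) (hL : 1 ≤ L) :
    2 * N_D L = N_C L + Nat.choose L (L / 2) := by
  have : NeZero L := ⟨by omega⟩
  exact burnside_pair L _ (fun t => (card_Fx_eq t (-1)).trans card_Fx)
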